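/- A continuously differentiable function y : [0,1] → [0,∞) solves the boundary value problem y′(t) − p(t)y(t) = Σ_{i=1}^m f_i(t,y(t)) for t ∈ [0,1] with λ y(0) = y(1) + Σ_{j=1}^n Φ_j(τ_j, y(τ_j)) if and only if y is a fixed point of the operator K defined by (Ky)(t) := ∫_0^1 G(t,s) Σ_{i=1}^m f_i(s,y(s)) ds + (exp(∫_0^t p(η)dη)/(λ−E))·Σ_{j=1}^n Φ_j(τ_j, y(τ_j)). -/

import Mathlib

open Set

theorem aux_ftc (g : ℝ → ℝ) (hg : ContinuousOn g (Icc (0:ℝ) 1)) (t : ℝ) (ht : t ∈ Icc (0:ℝ) 1) :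
    HasDerivWithinAt (fun x => ∫ s in (0:ℝ)..x, g s) (g t) (Icc (0:ℝ) 1) t := by
  have : Fact (t ∈ Icc (0:ℝ) 1) := ⟨ht⟩
  refine intervalIntegral.integral_hasDerivWithinAt_right (s := Icc (0:ℝ) 1) (t := Icc (0:ℝ) 1)
    ?_ ?_ (hg t ht)
  · apply ContinuousOn.intervalIntegrable
    rw [uIcc_of_le ht.1]
    exact hg.mono (Icc_subset_Icc_right ht.2)
  · exact hg.stronglyMeasurableAtFilter_nhdsWithin measurableSet_Icc t

/-- A continuously differentiable nonnegative `y` solves the nonlinear boundary value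
problem if and only if it is a fixed point of the operator `K`. -/
theorem bvp_iff_fixed_point
    (p : ℝ → ℝ) (hp : ContinuousOn p (Icc (0:ℝ) 1))
    (hp0 : ∀ t ∈ Icc (0:ℝ) 1, 0 ≤ p t)
    (E : ℝ) (hE : E = Real.exp (∫ η in (0:ℝ)..1, p η))
    (lam : ℝ) (hlam : E < lam)
    (n m : ℕ) (τ : Fin n → ℝ) (hτ : ∀ j, τ j ∈ Icc (0:ℝ) 1) (hτmono : StrictMono τ)
    (f : Fin m → ℝ → ℝ → ℝ)
    (hfc : ∀ i, ContinuousOn (fun q : ℝ × ℝ => f i q.1 q.2) (Icc (0:ℝ) 1 ×ˢ Ici (0:ℝ)))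
    (hf0 : ∀ i, ∀ t ∈ Icc (0:ℝ) 1, ∀ z ≥ (0:ℝ), 0 ≤ f i t z)
    (Φ : Fin n → ℝ → ℝ → ℝ)
    (hΦc : ∀ j, ContinuousOn (fun q : ℝ × ℝ => Φ j q.1 q.2) (Icc (0:ℝ) 1 ×ˢ Ici (0:ℝ)))
    (hΦ0 : ∀ j, ∀ t ∈ Icc (0:ℝ) 1, ∀ z ≥ (0:ℝ), 0 ≤ Φ j t z)
    (G : ℝ → ℝ → ℝ)
    (hG : ∀ t s : ℝ, G t s =
      Real.exp (∫ η in s..t, p η) / (lam - E) * (if s < t then lam else E))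
    (K : (ℝ → ℝ) → ℝ → ℝ)
    (hK : ∀ z : ℝ → ℝ, ∀ t : ℝ, K z t =
      (∫ s in (0:ℝ)..1, G t s * ∑ i, f i s (z s)) +
      Real.exp (∫ η in (0:ℝ)..t, p η) / (lam - E) * ∑ j, Φ j (τ j) (z (τ j)))
    -- y is continuously differentiable on [0,1] with derivative y', and nonnegative
    (y y' : ℝ → ℝ) (hy'c : ContinuousOn y' (Icc (0:ℝ) 1))
    (hyd : ∀ t ∈ Icc (0:ℝ) 1, HasDerivWithinAt y (y' t) (Icc (0:ℝ) 1) t)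
    (hy0 : ∀ t ∈ Icc (0:ℝ) 1, 0 ≤ y t) :
    ((∀ t ∈ Icc (0:ℝ) 1, y' t - p t * y t = ∑ i, f i t (y t)) ∧
      lam * y 0 = y 1 + ∑ j, Φ j (τ j) (y (τ j))) ↔
    (∀ t ∈ Icc (0:ℝ) 1, y t = K y t) := by
  have hle : (0:ℝ) ≠ lam - E := by intro h; linarith
  have hne : lam - E ≠ 0 := hle.symm
  have h0 : (0:ℝ) ∈ Icc (0:ℝ) 1 := by simp
  have h1 : (1:ℝ) ∈ Icc (0:ℝ) 1 := by simp
  have hII : ∀ g : ℝ → ℝ, ContinuousOn g (Icc (0:ℝ) 1) → ∀ a ∈ Icc (0:ℝ) 1, ∀ b ∈ Icc (0:ℝ) 1,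
      IntervalIntegrable g MeasureTheory.volume a b := by
    intro g hg a ha b hb
    exact (hg.mono (ordConnected_Icc.uIcc_subset ha hb)).intervalIntegrable
  have hyc : ContinuousOn y (Icc (0:ℝ) 1) := fun t ht => (hyd t ht).continuousWithinAt
  obtain ⟨F, hF⟩ : ∃ F : ℝ → ℝ, ∀ t, F t = ∑ i, f i t (y t) := ⟨_, fun _ => rfl⟩
  obtain ⟨S, hS⟩ : ∃ S : ℝ, S = ∑ j, Φ j (τ j) (y (τ j)) := ⟨_, rfl⟩
  have hFc : ContinuousOn F (Icc (0:ℝ) 1) := by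
    have : F = fun t => ∑ i, f i t (y t) := funext hF
    rw [this]
    refine continuousOn_finsetSum _ fun i _ => ?_
    exact (hfc i).comp (continuousOn_id.prodMk hyc) fun t ht => ⟨ht, hy0 t ht⟩
  obtain ⟨P, hP⟩ : ∃ P : ℝ → ℝ, ∀ t, P t = ∫ η in (0:ℝ)..t, p η := ⟨_, fun _ => rfl⟩
  have hPd : ∀ t ∈ Icc (0:ℝ) 1, HasDerivWithinAt P (p t) (Icc (0:ℝ) 1) t := by
    rw [show P = _ from funext hP]
    exact aux_ftc p hp
  have hPc : ContinuousOn P (Icc (0:ℝ) 1) := fun t ht => (hPd t ht).continuousWithinAt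
  have hP0 : P 0 = 0 := by simp [hP]
  have hP1 : Real.exp (P 1) = E := by rw [hE, hP]
  obtain ⟨g, hg⟩ : ∃ g : ℝ → ℝ, ∀ t, g t = Real.exp (-P t) * F t := ⟨_, fun _ => rfl⟩
  have hgc : ContinuousOn g (Icc (0:ℝ) 1) := by
    rw [show g = _ from funext hg]
    exact hPc.neg.rexp.mul hFc
  obtain ⟨I, hI⟩ : ∃ I : ℝ → ℝ, ∀ t, I t = ∫ s in (0:ℝ)..t, g s := ⟨_, fun _ => rfl⟩
  have hId : ∀ t ∈ Icc (0:ℝ) 1, HasDerivWithinAt I (g t) (Icc (0:ℝ) 1) t := by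
    rw [show I = _ from funext hI]
    exact aux_ftc g hgc
  have hI0 : I 0 = 0 := by simp [hI]
  have hexp : ∀ t, Real.exp (P t) * Real.exp (-P t) = 1 := by
    intro t; rw [← Real.exp_add]; simp
  have hKf : ∀ t ∈ Icc (0:ℝ) 1, K y t =
      Real.exp (P t) / (lam - E) * (lam * I t + E * (I 1 - I t) + S) := by
    intro t ht
    have hGs : ∀ s ∈ Icc (0:ℝ) 1, G t s * ∑ i, f i s (y s) =
        Real.exp (P t) / (lam - E) * (if s < t then lam else E) * g s := by
      intro s hs
      have : ∫ η in s..t, p η = P t + -P s := by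
        rw [hP, hP, ← intervalIntegral.integral_interval_sub_left (hII p hp 0 h0 t ht)
          (hII p hp 0 h0 s hs)]
        ring
      rw [hG, this, Real.exp_add, hg, hF]
      ring
    have e1 : ∀ s ∈ Ioo 0 t, G t s * ∑ i, f i s (y s) =
        Real.exp (P t) / (lam - E) * lam * g s := by
      intro s hs
      rw [hGs s ⟨hs.1.le, hs.2.le.trans ht.2⟩, if_pos hs.2]
    have e2 : ∀ s ∈ Icc t 1, G t s * ∑ i, f i s (y s) =
        Real.exp (P t) / (lam - E) * E * g s := by
      intro s hs
      rw [hGs s ⟨ht.1.trans hs.1, hs.2⟩, if_neg (not_lt.2 hs.1)]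
    have i1 := (hII g hgc 0 h0 t ht).const_mul (Real.exp (P t) / (lam - E) * lam)
    have i2 := (hII g hgc t ht 1 h1).const_mul (Real.exp (P t) / (lam - E) * E)
    have j1 : IntervalIntegrable (fun s => G t s * ∑ i, f i s (y s)) MeasureTheory.volume 0 t := by
      refine i1.congr_uIoo ?_
      rw [uIoo_of_le ht.1]
      intro s hs
      exact (e1 s hs).symm
    have j2 : IntervalIntegrable (fun s => G t s * ∑ i, f i s (y s)) MeasureTheory.volume t 1 := by
      refine i2.congr_uIoo ?_
      rw [uIoo_of_le ht.2]
      intro s hs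
      exact (e2 s (Ioo_subset_Icc_self hs)).symm
    have k1 : ∫ s in (0:ℝ)..t, G t s * ∑ i, f i s (y s) =
        Real.exp (P t) / (lam - E) * lam * I t := by
      rw [hI, ← intervalIntegral.integral_const_mul]
      refine intervalIntegral.integral_congr_uIoo ?_
      rw [uIoo_of_le ht.1]
      exact e1
    have k2 : ∫ s in t..1, G t s * ∑ i, f i s (y s) =
        Real.exp (P t) / (lam - E) * E * (I 1 - I t) := by
      rw [hI, hI, intervalIntegral.integral_interval_sub_left (hII g hgc 0 h0 1 h1)
          (hII g hgc 0 h0 t ht), ← intervalIntegral.integral_const_mul]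
      refine intervalIntegral.integral_congr ?_
      rw [uIcc_of_le ht.2]
      exact e2
    rw [hK, ← intervalIntegral.integral_add_adjacent_intervals j1 j2, k1, k2, ← hS, ← hP]
    ring
  rw [← hS]
  constructor
  · rintro ⟨hode, hbc⟩ t ht
    have hD : ∀ x ∈ Icc (0:ℝ) 1,
        HasDerivWithinAt (fun x => Real.exp (-P x) * y x - I x) 0 (Icc (0:ℝ) 1) x := by
      intro x hx
      have := (((hPd x hx).neg.exp).mul (hyd x hx)).sub (hId x hx)
      refine this.congr_deriv ?_
      have h2 := hode x hx
      rw [← hF] at h2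
      rw [hg, ← h2]
      simp only [Pi.neg_apply]
      ring
    have hconst : ∀ x ∈ Icc (0:ℝ) 1, Real.exp (-P x) * y x - I x = y 0 := by
      intro x hx
      have := (convex_Icc (0:ℝ) 1).norm_image_sub_le_of_norm_hasDerivWithin_le (C := 0) hD
        (by simp) h0 hx
      simp only [zero_mul, norm_le_zero_iff, hP0, hI0] at this
      simp at this
      linarith
    have hsol : ∀ x ∈ Icc (0:ℝ) 1, y x = Real.exp (P x) * (y 0 + I x) := by
      intro x hx
      rw [← hconst x hx]
      linear_combination (-y x) * hexp x
    have hy1 := hsol 1 h1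
    rw [hP1] at hy1
    rw [hKf t ht, hsol t ht]
    field_simp
    linear_combination hbc + hy1
  · intro hfix
    have hfix' : ∀ t ∈ Icc (0:ℝ) 1, y t =
      Real.exp (P t) / (lam - E) * (lam * I t + E * (I 1 - I t) + S) :=
      fun t ht => (hfix t ht).trans (hKf t ht)
    constructor
    · intro t ht
      have hd := (((hPd t ht).exp.div_const (lam - E)).mul
        ((((hId t ht).const_mul lam).add (((hId t ht).const_sub (I 1)).const_mul E)).add_const S))
      have hd2 := hd.congr (f₁ := y) (fun x hx => hfix' x hx) (hfix' t ht)
      have hu := (uniqueDiffOn_Icc (zero_lt_one (α := ℝ)) t ht).eq_deriv _ (hyd t ht) hd2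
      rw [← hF, hu, hfix' t ht, hg]
      simp only [Pi.add_apply]
      have hx := hexp t
      generalize Real.exp (P t) = a at *
      generalize Real.exp (-P t) = b at *
      field_simp
      linear_combination F t * (lam - E) * hx
    · rw [hfix' 0 h0, hfix' 1 h1, hP1, hP0, hI0]
      simp
      field_simp
      ring
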